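/- arXiv:1811.11642 — 2 statements merged into one kernel-verified Lean document; each statement's English description precedes it below -/
import Mathlib

section
/- For n = 3 there exists a nonzero constant c ∈ ℂ such that for all z ∈ ℂ: det(A_3(z)) = c·z^{15}·(8·cos(z) + cos(2z) + 2·cos(z)·cosh(√3·z) + 16·cos(z/2)·cosh((√3/2)·z) + 9). In particular, for λ > 0 the eigenvalue condition det(A_3(λ^{−1/6})) = 0 is equivalent to the transcendental equation 8·cos(λ^{−1/6}) + cos(2λ^{−1/6}) + 2·cos(λ^{−1/6})·cosh(√3·λ^{−1/6}) + 16·cos(λ^{−1/6}/2)·cosh((√3/2)·λ^{−1/6}) + 9 = 0. -/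
open Real Complex

/-- ω_k = exp(iπ(2k + [n]₂)/(2n)). -/
noncomputable def omegaRoot (n k : ℕ) : ℂ :=
  Complex.exp (Complex.I * (Real.pi : ℂ) * (2 * (k : ℂ) + ((n % 2 : ℕ) : ℂ)) / (2 * (n : ℂ)))

/-- The matrix A_n(z) with entries ω_k^j z^j e^{ω_k z} for j < n and ω_k^j z^j for
j ≥ n. -/
noncomputable def An (n : ℕ) (z : ℂ) : Matrix (Fin (2 * n)) (Fin (2 * n)) ℂ :=
  Matrix.of (fun j k : Fin (2 * n) =>
    if (j : ℕ) < n then omegaRoot n k ^ (j : ℕ) * z ^ (j : ℕ) * Complex.exp (omegaRoot n k * z)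
    else omegaRoot n k ^ (j : ℕ) * z ^ (j : ℕ))

/-- The expression appearing in the transcendental equation for n = 3. -/
noncomputable def F3 (z : ℂ) : ℂ :=
  8 * Complex.cos z + Complex.cos (2 * z) +
    2 * Complex.cos z * Complex.cosh (((Real.sqrt 3 : ℝ) : ℂ) * z) +
    16 * Complex.cos (z / 2) * Complex.cosh (((Real.sqrt 3 / 2 : ℝ) : ℂ) * z) + 9

set_option maxHeartbeats 1000000 in
/-- Laplace expansion along the first three rows of the `6 × 6` Vandermonde matrix whose first
three rows are weighted by `e`. -/
theorem det_expVandermonde_six {R : Type*} [CommRing R] (e x : Fin 6 → R) :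
    (Matrix.of fun j k : Fin 6 => if (j : ℕ) < 3 then x k ^ (j : ℕ) * e k else x k ^ (j : ℕ)).det =
      e 0 * e 1 * e 2 * ((x 1 - x 0) * (x 2 - x 0) * (x 2 - x 1)) *
        (x 3 * x 4 * x 5) ^ 3 * ((x 4 - x 3) * (x 5 - x 3) * (x 5 - x 4))
      - e 0 * e 1 * e 3 * ((x 1 - x 0) * (x 3 - x 0) * (x 3 - x 1)) *
        (x 2 * x 4 * x 5) ^ 3 * ((x 4 - x 2) * (x 5 - x 2) * (x 5 - x 4))
      + e 0 * e 1 * e 4 * ((x 1 - x 0) * (x 4 - x 0) * (x 4 - x 1)) *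
        (x 2 * x 3 * x 5) ^ 3 * ((x 3 - x 2) * (x 5 - x 2) * (x 5 - x 3))
      - e 0 * e 1 * e 5 * ((x 1 - x 0) * (x 5 - x 0) * (x 5 - x 1)) *
        (x 2 * x 3 * x 4) ^ 3 * ((x 3 - x 2) * (x 4 - x 2) * (x 4 - x 3))
      + e 0 * e 2 * e 3 * ((x 2 - x 0) * (x 3 - x 0) * (x 3 - x 2)) *
        (x 1 * x 4 * x 5) ^ 3 * ((x 4 - x 1) * (x 5 - x 1) * (x 5 - x 4))
      - e 0 * e 2 * e 4 * ((x 2 - x 0) * (x 4 - x 0) * (x 4 - x 2)) *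
        (x 1 * x 3 * x 5) ^ 3 * ((x 3 - x 1) * (x 5 - x 1) * (x 5 - x 3))
      + e 0 * e 2 * e 5 * ((x 2 - x 0) * (x 5 - x 0) * (x 5 - x 2)) *
        (x 1 * x 3 * x 4) ^ 3 * ((x 3 - x 1) * (x 4 - x 1) * (x 4 - x 3))
      + e 0 * e 3 * e 4 * ((x 3 - x 0) * (x 4 - x 0) * (x 4 - x 3)) *
        (x 1 * x 2 * x 5) ^ 3 * ((x 2 - x 1) * (x 5 - x 1) * (x 5 - x 2))
      - e 0 * e 3 * e 5 * ((x 3 - x 0) * (x 5 - x 0) * (x 5 - x 3)) *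
        (x 1 * x 2 * x 4) ^ 3 * ((x 2 - x 1) * (x 4 - x 1) * (x 4 - x 2))
      + e 0 * e 4 * e 5 * ((x 4 - x 0) * (x 5 - x 0) * (x 5 - x 4)) *
        (x 1 * x 2 * x 3) ^ 3 * ((x 2 - x 1) * (x 3 - x 1) * (x 3 - x 2))
      - e 1 * e 2 * e 3 * ((x 2 - x 1) * (x 3 - x 1) * (x 3 - x 2)) *
        (x 0 * x 4 * x 5) ^ 3 * ((x 4 - x 0) * (x 5 - x 0) * (x 5 - x 4))
      + e 1 * e 2 * e 4 * ((x 2 - x 1) * (x 4 - x 1) * (x 4 - x 2)) *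
        (x 0 * x 3 * x 5) ^ 3 * ((x 3 - x 0) * (x 5 - x 0) * (x 5 - x 3))
      - e 1 * e 2 * e 5 * ((x 2 - x 1) * (x 5 - x 1) * (x 5 - x 2)) *
        (x 0 * x 3 * x 4) ^ 3 * ((x 3 - x 0) * (x 4 - x 0) * (x 4 - x 3))
      - e 1 * e 3 * e 4 * ((x 3 - x 1) * (x 4 - x 1) * (x 4 - x 3)) *
        (x 0 * x 2 * x 5) ^ 3 * ((x 2 - x 0) * (x 5 - x 0) * (x 5 - x 2))
      + e 1 * e 3 * e 5 * ((x 3 - x 1) * (x 5 - x 1) * (x 5 - x 3)) *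
        (x 0 * x 2 * x 4) ^ 3 * ((x 2 - x 0) * (x 4 - x 0) * (x 4 - x 2))
      - e 1 * e 4 * e 5 * ((x 4 - x 1) * (x 5 - x 1) * (x 5 - x 4)) *
        (x 0 * x 2 * x 3) ^ 3 * ((x 2 - x 0) * (x 3 - x 0) * (x 3 - x 2))
      + e 2 * e 3 * e 4 * ((x 3 - x 2) * (x 4 - x 2) * (x 4 - x 3)) *
        (x 0 * x 1 * x 5) ^ 3 * ((x 1 - x 0) * (x 5 - x 0) * (x 5 - x 1))
      - e 2 * e 3 * e 5 * ((x 3 - x 2) * (x 5 - x 2) * (x 5 - x 3)) *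
        (x 0 * x 1 * x 4) ^ 3 * ((x 1 - x 0) * (x 4 - x 0) * (x 4 - x 1))
      + e 2 * e 4 * e 5 * ((x 4 - x 2) * (x 5 - x 2) * (x 5 - x 4)) *
        (x 0 * x 1 * x 3) ^ 3 * ((x 1 - x 0) * (x 3 - x 0) * (x 3 - x 1))
      - e 3 * e 4 * e 5 * ((x 4 - x 3) * (x 5 - x 3) * (x 5 - x 4)) *
        (x 0 * x 1 * x 2) ^ 3 * ((x 1 - x 0) * (x 2 - x 0) * (x 2 - x 1)) := by
  simp [Matrix.det_succ_row_zero, Fin.sum_univ_succ, Fin.succAbove]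
  ring

set_option maxHeartbeats 1000000 in
theorem det_expVandermonde_of_twelfth_root {R : Type*} [CommRing R] {u a b a' b' : R}
    (hu : u ^ 4 = u ^ 2 - 1) (ha : a * a' = 1) (hb : b * b' = 1) (e x : Fin 6 → R)
    (he : e = ![a, a * b, b, a', a' * b', b'])
    (hx : x = ![u, u ^ 3, u ^ 3 - u, -u, -u ^ 3, u - u ^ 3]) :
    (Matrix.of fun j k : Fin 6 => if (j : ℕ) < 3 then x k ^ (j : ℕ) * e k else x k ^ (j : ℕ)).det =
      u ^ 3 * (24 * (a * b + a' * b') + 3 * ((a * b) ^ 2 + (a' * b') ^ 2) +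
        3 * (a ^ 2 + b ^ 2 + a' ^ 2 + b' ^ 2) + 24 * (a + b + a' + b') + 54) := by
  subst he hx
  rw [det_expVandermonde_six]
  simp
  grind

theorem omegaRoot_three_zero : omegaRoot 3 0 = (((√3 : ℝ) : ℂ) + Complex.I) / 2 := by
  have h : Complex.I * (Real.pi : ℂ) * (2 * ((0 : ℕ) : ℂ) + ((3 % 2 : ℕ) : ℂ)) / (2 * ((3 : ℕ) : ℂ))
      = ((Real.pi / 6 : ℝ) : ℂ) * Complex.I := by
    push_cast
    ring
  rw [omegaRoot, h, Complex.exp_mul_I, ← Complex.ofReal_cos, ← Complex.ofReal_sin,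
    Real.cos_pi_div_six, Real.sin_pi_div_six]
  push_cast
  ring

theorem omegaRoot_three (k : ℕ) : omegaRoot 3 k = omegaRoot 3 0 ^ (2 * k + 1) := by
  rw [omegaRoot, omegaRoot, ← Complex.exp_nat_mul]
  congr 1
  push_cast
  ring

theorem ofReal_sqrt_three_sq : ((√3 : ℝ) : ℂ) ^ 2 = 3 := by
  rw [← Complex.ofReal_pow, Real.sq_sqrt (by norm_num)]
  norm_num

theorem omegaRoot_three_zero_pow_three : omegaRoot 3 0 ^ 3 = Complex.I := by
  rw [omegaRoot_three_zero]
  grind [ofReal_sqrt_three_sq, Complex.I_sq]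

theorem omegaRoot_three_zero_pow_four : omegaRoot 3 0 ^ 4 = omegaRoot 3 0 ^ 2 - 1 := by
  rw [omegaRoot_three_zero]
  grind [ofReal_sqrt_three_sq, Complex.I_sq]

theorem F3_eq_exp (z : ℂ) {u : ℂ} (hu : u = (((√3 : ℝ) : ℂ) + Complex.I) / 2) :
    6 * F3 z =
      24 * (Complex.exp (u * z) * Complex.exp ((Complex.I - u) * z) +
          Complex.exp (-(u * z)) * Complex.exp (-((Complex.I - u) * z))) +
        3 * ((Complex.exp (u * z) * Complex.exp ((Complex.I - u) * z)) ^ 2 +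
          (Complex.exp (-(u * z)) * Complex.exp (-((Complex.I - u) * z))) ^ 2) +
        3 * (Complex.exp (u * z) ^ 2 + Complex.exp ((Complex.I - u) * z) ^ 2 +
          Complex.exp (-(u * z)) ^ 2 + Complex.exp (-((Complex.I - u) * z)) ^ 2) +
        24 * (Complex.exp (u * z) + Complex.exp ((Complex.I - u) * z) +
          Complex.exp (-(u * z)) + Complex.exp (-((Complex.I - u) * z))) + 54 := by
  subst hu
  simp only [F3, Complex.cos, Complex.cosh, ← Complex.exp_nat_mul, ← Complex.exp_add]
  ring_nf
  simp only [← Complex.exp_add]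
  push_cast
  ring_nf

theorem det_An_three (z : ℂ) : (An 3 z).det = 6 * Complex.I * z ^ 15 * F3 z := by
  set u := omegaRoot 3 0 with hu
  have h3 : u ^ 3 = Complex.I := omegaRoot_three_zero_pow_three
  have h4 : u ^ 4 = u ^ 2 - 1 := omegaRoot_three_zero_pow_four
  have hx : (fun k : Fin 6 => omegaRoot 3 k) =
      ![u, u ^ 3, u ^ 3 - u, -u, -u ^ 3, u - u ^ 3] := by
    funext k
    rw [omegaRoot_three, ← hu]
    fin_cases k <;> simp <;> grind
  have he : (fun k : Fin 6 => Complex.exp (omegaRoot 3 k * z)) =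
      ![Complex.exp (u * z), Complex.exp (u * z) * Complex.exp ((Complex.I - u) * z),
        Complex.exp ((Complex.I - u) * z), Complex.exp (-(u * z)),
        Complex.exp (-(u * z)) * Complex.exp (-((Complex.I - u) * z)),
        Complex.exp (-((Complex.I - u) * z))] := by
    funext k
    rw [congrFun hx k, h3]
    fin_cases k <;> simp [← Complex.exp_add] <;> ring_nf
  have hA : An 3 z = Matrix.of fun j k : Fin 6 => z ^ (j : ℕ) *
      (Matrix.of fun j k : Fin 6 => if (j : ℕ) < 3
        then (fun k : Fin 6 => omegaRoot 3 k) k ^ (j : ℕ) *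
          (fun k : Fin 6 => Complex.exp (omegaRoot 3 k * z)) k
        else (fun k : Fin 6 => omegaRoot 3 k) k ^ (j : ℕ)) j k := by
    ext j k
    simp only [An, Matrix.of_apply]
    split_ifs <;> ring
  have hz : ∏ j : Fin 6, z ^ (j : ℕ) = z ^ 15 := by
    simp [Fin.prod_univ_succ]
    ring
  have hF := F3_eq_exp z (u := u) omegaRoot_three_zero
  have hD := det_expVandermonde_of_twelfth_root h4 (a := Complex.exp (u * z))
    (b := Complex.exp ((Complex.I - u) * z)) (by simp [← Complex.exp_add])
    (by simp [← Complex.exp_add]) _ _ he hx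
  calc (An 3 z).det
      = z ^ 15 * (u ^ 3 * (6 * F3 z)) := by
        rw [hA, hF, ← hD, ← hz]
        exact Matrix.det_mul_column _ _
    _ = 6 * Complex.I * z ^ 15 * F3 z := by
        rw [h3]
        ring

/-- For n = 3 there is a nonzero constant c with det(A_3(z)) = c·z^{15}·F₃(z) for all
z ∈ ℂ, where F₃(z) = 8cos(z) + cos(2z) + 2cos(z)cosh(√3 z) + 16cos(z/2)cosh((√3/2)z) + 9;
in particular, for λ > 0 the eigenvalue condition det(A_3(λ^{−1/6})) = 0 is equivalent to
the transcendental equation F₃(λ^{−1/6}) = 0. -/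
theorem det_A3_transcendental :
    ∃ c : ℂ, c ≠ 0 ∧
      (∀ z : ℂ, (An 3 z).det = c * z ^ 15 * F3 z) ∧
      (∀ lam : ℝ, 0 < lam →
        ((An 3 (((lam ^ (-(1 : ℝ) / 6) : ℝ)) : ℂ)).det = 0 ↔
          F3 (((lam ^ (-(1 : ℝ) / 6) : ℝ)) : ℂ) = 0)) := by
  refine ⟨6 * Complex.I, by simp, det_An_three, fun lam hlam => ?_⟩
  have h : (((lam ^ (-(1 : ℝ) / 6) : ℝ)) : ℂ) ≠ 0 :=
    Complex.ofReal_ne_zero.mpr (Real.rpow_pos_of_pos hlam _).ne'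
  rw [det_An_three]
  simp [h]
end

section
/- For n = 4 there exists a nonzero constant c ∈ ℂ such that for all z ∈ ℂ: det(A_4(z)) = c·z^{28}·( cos(√2·z) + cosh(√2·z) + 2·cos(z)·cosh(z) + 3·(cos(√2·z) + cosh(√2·z))·cos(z)·cosh(z) + 8·(cos(z) + cosh(z))·cos(z/√2)·cosh(z/√2) + 4√2·sin(z)·sin(z/√2)·cosh(z/√2) − 4√2·cos(z/√2)·sinh(z)·sinh(z/√2) + 2√2·sin(z)·sin(√2·z)·cosh(z) − 2√2·cos(z)·sinh(z)·sinh(√2·z) + 6 ). In particular, for λ > 0 the eigenvalue condition det(A_4(λ^{−1/8})) = 0 is equivalent to the vanishing of this expression at z = λ^{−1/8}. -/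
open Real Complex

/-- The expression appearing in the transcendental equation for n = 4. -/
noncomputable def F4 (z : ℂ) : ℂ :=
  Complex.cos (((Real.sqrt 2 : ℝ) : ℂ) * z) + Complex.cosh (((Real.sqrt 2 : ℝ) : ℂ) * z) +
    2 * Complex.cos z * Complex.cosh z +
    3 * (Complex.cos (((Real.sqrt 2 : ℝ) : ℂ) * z) + Complex.cosh (((Real.sqrt 2 : ℝ) : ℂ) * z)) *
      Complex.cos z * Complex.cosh z +
    8 * (Complex.cos z + Complex.cosh z) *
      Complex.cos (z / ((Real.sqrt 2 : ℝ) : ℂ)) * Complex.cosh (z / ((Real.sqrt 2 : ℝ) : ℂ)) +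
    4 * ((Real.sqrt 2 : ℝ) : ℂ) * Complex.sin z * Complex.sin (z / ((Real.sqrt 2 : ℝ) : ℂ)) *
      Complex.cosh (z / ((Real.sqrt 2 : ℝ) : ℂ)) -
    4 * ((Real.sqrt 2 : ℝ) : ℂ) * Complex.cos (z / ((Real.sqrt 2 : ℝ) : ℂ)) *
      Complex.sinh z * Complex.sinh (z / ((Real.sqrt 2 : ℝ) : ℂ)) +
    2 * ((Real.sqrt 2 : ℝ) : ℂ) * Complex.sin z * Complex.sin (((Real.sqrt 2 : ℝ) : ℂ) * z) *
      Complex.cosh z -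
    2 * ((Real.sqrt 2 : ℝ) : ℂ) * Complex.cos z * Complex.sinh z *
      Complex.sinh (((Real.sqrt 2 : ℝ) : ℂ) * z) + 6

/-- The sections `∑_{n ≡ r mod 8} zⁿ / n!` of the exponential series, in closed form. -/
noncomputable def expSection (z : ℂ) : Fin 8 → ℂ :=
  let s : ℂ := ((Real.sqrt 2 : ℝ) : ℂ)
  let a := Complex.cosh z
  let a' := Complex.sinh z
  let b := Complex.cos z
  let b' := Complex.sin z
  let p := Complex.cosh (z / s)
  let p' := Complex.sinh (z / s)
  let q := Complex.cos (z / s)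
  let q' := Complex.sin (z / s)
  ![(a + b + 2 * p * q) / 4, (a' + b' + s * (p' * q + p * q')) / 4,
    (a - b + 2 * p' * q') / 4, (a' - b' + s * (p * q' - p' * q)) / 4,
    (a + b - 2 * p * q) / 4, (a' + b' - s * (p' * q + p * q')) / 4,
    (a - b - 2 * p' * q') / 4, (a' - b' - s * (p * q' - p' * q)) / 4]

theorem ofReal_sqrt_two_sq : ((Real.sqrt 2 : ℝ) : ℂ) ^ 2 = 2 := by
  rw [← Complex.ofReal_pow, Real.sq_sqrt (by norm_num)]
  norm_num

theorem ofReal_sqrt_two_ne_zero : ((Real.sqrt 2 : ℝ) : ℂ) ≠ 0 := by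
  simp

theorem omegaRoot_four_one_isPrimitiveRoot : IsPrimitiveRoot (omegaRoot 4 1) 8 := by
  convert Complex.isPrimitiveRoot_exp 8 (by norm_num) using 1
  simp only [omegaRoot]
  congr 1
  push_cast
  ring

theorem omegaRoot_four (k : ℕ) : omegaRoot 4 k = omegaRoot 4 1 ^ k := by
  simp only [omegaRoot, ← Complex.exp_nat_mul]
  congr 1
  push_cast
  ring

theorem omegaRoot_four_one : omegaRoot 4 1 = (1 + Complex.I) / ((Real.sqrt 2 : ℝ) : ℂ) := by
  have h : omegaRoot 4 1 = Complex.exp (((Real.pi / 4 : ℝ) : ℂ) * Complex.I) := by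
    simp only [omegaRoot]
    congr 1
    push_cast
    ring
  rw [h, Complex.exp_mul_I, ← Complex.ofReal_cos, ← Complex.ofReal_sin, Real.cos_pi_div_four,
    Real.sin_pi_div_four]
  push_cast
  field_simp [ofReal_sqrt_two_ne_zero]
  rw [ofReal_sqrt_two_sq]

/-- The discrete Fourier transform of the sections recovers the exponentials `exp (ω_k z)`. -/
theorem sum_expSection_mul_pow (z : ℂ) (k : Fin 8) :
    ∑ r : Fin 8, expSection z r * (omegaRoot 4 1 ^ (k : ℕ)) ^ (r : ℕ) =
      Complex.exp (omegaRoot 4 1 ^ (k : ℕ) * z) := by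
  have hs := ofReal_sqrt_two_sq
  have hs0 := ofReal_sqrt_two_ne_zero
  have hw := omegaRoot_four_one
  set w := omegaRoot 4 1
  set s : ℂ := ((Real.sqrt 2 : ℝ) : ℂ) with hs'
  have hI := Complex.I_sq
  have hw1 : w * s = 1 + Complex.I := by rw [hw]; field_simp
  have hw2 : w ^ 2 = Complex.I := by
    rw [hw]
    field_simp
    linear_combination hI - Complex.I * hs
  have hw3 : s = w - w ^ 3 := by grind
  have hw4 : w ^ 4 = -1 := by grind
  have key : ∀ v x y : ℂ, v * z = x + y * Complex.I → Complex.exp (v * z) =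
      (Complex.cosh x + Complex.sinh x) * (Complex.cos y + Complex.sin y * Complex.I) := by
    intro v x y h
    rw [h, Complex.exp_add_mul_I, Complex.cosh_add_sinh]
  have hz : z = s * (z / s) := by field_simp
  simp only [Fin.sum_univ_eight, expSection, Fin.isValue, ← hs']
  clear_value w s
  obtain ⟨k, hk⟩ := k
  interval_cases k
  on_goal 1 => rw [key _ z 0 (by ring)]
  on_goal 2 => rw [key _ (z / s) (z / s) (by grind)]
  on_goal 3 => rw [key _ 0 z (by grind)]
  on_goal 4 => rw [key _ (-(z / s)) (z / s) (by grind)]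
  on_goal 5 => rw [key _ (-z) 0 (by grind), hw4]
  on_goal 6 => rw [key _ (-(z / s)) (-(z / s)) (by grind)]
  on_goal 7 => rw [key _ 0 (-z) (by grind)]
  on_goal 8 => rw [key _ (z / s) (-(z / s)) (by grind)]
  all_goals
    simp [-Complex.cosh_add_sinh, -Complex.cosh_sub_sinh]
    clear key hz hw hw1 hI hs hs0
    grind

theorem sum_expSection_sub_mul_pow (z : ℂ) (j k : Fin 8) :
    ∑ l : Fin 8, expSection z (l - j) * (omegaRoot 4 1 ^ (k : ℕ)) ^ (l : ℕ) =
      (omegaRoot 4 1 ^ (k : ℕ)) ^ (j : ℕ) * Complex.exp (omegaRoot 4 1 ^ (k : ℕ) * z) := by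
  rw [← sum_expSection_mul_pow, Finset.mul_sum]
  refine Fintype.sum_equiv (Equiv.subRight j) _ _ fun l => ?_
  have h : (omegaRoot 4 1 ^ (k : ℕ)) ^ 8 = 1 := by
    rw [← pow_mul, mul_comm, pow_mul, omegaRoot_four_one_isPrimitiveRoot.pow_eq_one, one_pow]
  rw [mul_left_comm, ← pow_add, Equiv.subRight_apply]
  congr 1
  rw [pow_eq_pow_mod (l : ℕ) h, pow_eq_pow_mod (_ + _) h]
  congr 1
  revert j l
  decide

theorem det_expSection_toeplitz (z : ℂ) :
    (Matrix.of fun j l : Fin 4 =>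
      expSection z (Fin.castLE (by norm_num) l - Fin.castLE (by norm_num) j)).det =
      F4 z / 32 := by
  have hs := ofReal_sqrt_two_sq
  have hs0 := ofReal_sqrt_two_ne_zero
  have hz : ((Real.sqrt 2 : ℝ) : ℂ) * z = 2 * (z / ((Real.sqrt 2 : ℝ) : ℂ)) := by
    field_simp
    rw [hs, mul_comm]
  rw [F4, hz, Complex.cos_two_mul, Complex.sin_two_mul, Complex.cosh_two_mul,
    Complex.sinh_two_mul]
  have h1 := Complex.cosh_sq_sub_sinh_sq z
  have h2 := Complex.cos_sq_add_sin_sq z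
  have h3 := Complex.cosh_sq_sub_sinh_sq (z / ((Real.sqrt 2 : ℝ) : ℂ))
  have h4 := Complex.cos_sq_add_sin_sq (z / ((Real.sqrt 2 : ℝ) : ℂ))
  simp only [expSection]
  generalize Complex.cosh (z / ((Real.sqrt 2 : ℝ) : ℂ)) = p at *
  generalize Complex.sinh (z / ((Real.sqrt 2 : ℝ) : ℂ)) = p' at *
  generalize Complex.cos (z / ((Real.sqrt 2 : ℝ) : ℂ)) = q at *
  generalize Complex.sin (z / ((Real.sqrt 2 : ℝ) : ℂ)) = q' at *
  generalize Complex.cosh z = a at *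
  generalize Complex.sinh z = a' at *
  generalize Complex.cos z = b at *
  generalize Complex.sin z = b' at *
  generalize ((Real.sqrt 2 : ℝ) : ℂ) = s at *
  clear hz hs0
  have e : ∀ f : Fin 8 → ℂ, (Matrix.of fun j l : Fin 4 =>
      f (Fin.castLE (by norm_num) l - Fin.castLE (by norm_num) j)) =
      !![f 0, f 1, f 2, f 3; f 7, f 0, f 1, f 2; f 6, f 7, f 0, f 1; f 5, f 6, f 7, f 0] := by
    intro f
    ext i j
    fin_cases i <;> fin_cases j <;> rfl
  rw [e]
  simp [Matrix.det_succ_row_zero, Fin.sum_univ_succ, Fin.succAbove]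
  linear_combination ((1/32) + (3/32)*a*b) * h3 +
    ((-1/64)*p'^2*q^2*b'^2 + (-1/64)*p'^2*q^2*b^2 + (1/64)*p'^2*q^2*a'^2 +
    (-1/32)*p'^2*q^2*a*b + (-1/64)*p'^2*q^2*a^2 + (1/32)*p'^3*q^3*a'*s + (1/16)*p'^4*q^2*q'^2
    + (1/32)*p'^4*q^4 + (1/64)*p'^4*q^4*s^2 + (-1/8)*p*p'^2*q*q'^2*b + (-1/8)*p*p'^2*q*q'^2*a
    + (1/32)*p*p'^2*q^2*q'*b'*s + (-1/16)*p*p'^2*q^3*b + (-1/16)*p*p'^2*q^3*a +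
    (1/64)*p^2*q'^2*b'^2 + (1/64)*p^2*q'^2*b^2 + (-1/64)*p^2*q'^2*a'^2 + (1/32)*p^2*q'^2*a*b +
    (1/64)*p^2*q'^2*a^2 + (1/32)*p^2*p'*q*q'^2*a'*s + (-1/16)*p^2*p'^2*q'^4 +
    (-3/16)*p^2*p'^2*q^2*q'^2 + (1/32)*p^2*p'^2*q^2*q'^2*s^2 + (-1/16)*p^2*p'^2*q^4 +
    (1/32)*p^3*q'^3*b'*s + (1/16)*p^3*q*q'^2*b + (1/16)*p^3*q*q'^2*a + (1/32)*p^4*q'^4 +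
    (1/64)*p^4*q'^4*s^2 + (1/16)*p^4*q^2*q'^2) * hs  + ((1/16)*b'^2 + (1/16)*b^2 +
    (-1/32)*p'^2*q^2 + (1/16)*p*q'*b'*s + (1/8)*p*q*b + (1/32)*p^2*q'^2 + (1/16)*p^2*q^2) * h1
    + ((1/16) + (-1/16)*p'*q*a'*s + (-1/32)*p'^2*q^2 + (1/8)*p*q*a + (1/32)*p^2*q'^2 +
    (1/16)*p^2*q^2) * h2  + ((-1/8)*q'^2*a*b + (1/16)*q'^4 + (1/8)*q*q'*a*b'*s + (1/16)*q^2 +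
    (1/16)*q^2*a*b + (1/8)*q^2*q'^2 + (1/16)*q^4 + (-1/16)*p'*q*q'^2*a'*s +
    (-1/16)*p'*q^3*a'*s + (-1/16)*p'^2*q'^4 + (-1/8)*p'^2*q^2*q'^2 + (-1/16)*p'^2*q^4 +
    (1/16)*p*q'^3*b'*s + (1/8)*p*q*q'^2*b + (1/8)*p*q*q'^2*a + (1/16)*p*q^2*q'*b'*s +
    (1/8)*p*q^3*b + (1/8)*p*q^3*a + (1/16)*p^2*q'^4 + (1/8)*p^2*q^2*q'^2 + (1/16)*p^2*q^4) *
    h3  + ((1/16) + (-1/8)*a*b + (1/16)*q'^2 + (1/16)*q^2 + (-1/16)*p'*q*a'*s +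
    (1/16)*p*q'*b'*s + (1/8)*p*q*b + (1/8)*p*q*a + (-1/8)*p*p'*a'*b*s + (1/16)*p^2 +
    (3/16)*p^2*a*b) * h4

/-- Factoring a diagonal matrix on the left and the discrete Fourier matrix on the right of
`An 4 z` leaves a Toeplitz block above a block of the identity. -/
theorem An_four_eq_mul (z : ℂ) :
    An 4 z = Matrix.diagonal (fun j : Fin 8 => z ^ (j : ℕ)) *
      ((Matrix.of fun j l : Fin 8 =>
        if (j : ℕ) < 4 then expSection z (l - j) else if j = l then 1 else 0) *
      (Matrix.vandermonde fun k : Fin 8 => omegaRoot 4 1 ^ (k : ℕ)).transpose) := by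
  ext j k
  change Fin 8 at j k
  rw [Matrix.diagonal_mul, Matrix.mul_apply]
  simp only [An, Matrix.of_apply, Matrix.transpose_apply, Matrix.vandermonde_apply]
  rw [omegaRoot_four]
  split_ifs with h
  · rw [sum_expSection_sub_mul_pow]
    ring
  · simp [mul_comm]

theorem det_of_ite_toeplitz (z : ℂ) :
    (Matrix.of fun j l : Fin 8 =>
        if (j : ℕ) < 4 then expSection z (l - j) else if j = l then 1 else 0).det =
      F4 z / 32 := by
  rw [← det_expSection_toeplitz, ← Matrix.det_reindex_self (finSumFinEquiv (m := 4) (n := 4)).symm]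
  rw [← Matrix.fromBlocks_toBlocks (Matrix.reindex _ _ _)]
  rw [show Matrix.toBlocks₂₁ _ = 0 from ?_, show Matrix.toBlocks₂₂ _ = 1 from ?_,
    Matrix.det_fromBlocks_zero₂₁, Matrix.det_one, mul_one]
  · congr 1
    ext i j
    fin_cases i <;> fin_cases j <;> rfl
  · ext i j
    refine (if_neg (by fin_cases i <;> decide)).trans ?_
    fin_cases i <;> fin_cases j <;> rfl
  · ext i j
    exact (if_neg (by fin_cases i <;> decide)).trans
      (if_neg (by fin_cases i <;> fin_cases j <;> decide))

theorem det_An_four (z : ℂ) :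
    (An 4 z).det =
      (Matrix.vandermonde fun k : Fin 8 => omegaRoot 4 1 ^ (k : ℕ)).det / 32 * z ^ 28 * F4 z := by
  have h : ∏ j : Fin 8, z ^ (j : ℕ) = z ^ 28 := by
    rw [Finset.prod_pow_eq_pow_sum]
    rfl
  rw [An_four_eq_mul]
  change (_ : Matrix (Fin 8) (Fin 8) ℂ).det = _
  rw [Matrix.det_mul, Matrix.det_mul, Matrix.det_diagonal, Matrix.det_transpose,
    det_of_ite_toeplitz, h]
  ring

/-- For n = 4 there is a nonzero constant c with det(A_4(z)) = c·z^{28}·F₄(z) for all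
z ∈ ℂ, where F₄ is the expression from Corollary 5 of the paper; in particular, for
λ > 0 the eigenvalue condition det(A_4(λ^{−1/8})) = 0 is equivalent to
F₄(λ^{−1/8}) = 0. -/
theorem det_A4_transcendental :
    ∃ c : ℂ, c ≠ 0 ∧
      (∀ z : ℂ, (An 4 z).det = c * z ^ 28 * F4 z) ∧
      (∀ lam : ℝ, 0 < lam →
        ((An 4 (((lam ^ (-(1 : ℝ) / 8) : ℝ)) : ℂ)).det = 0 ↔
          F4 (((lam ^ (-(1 : ℝ) / 8) : ℝ)) : ℂ) = 0)) := by
  have hc : (Matrix.vandermonde fun k : Fin 8 => omegaRoot 4 1 ^ (k : ℕ)).det / 32 ≠ 0 := by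
    refine div_ne_zero (Matrix.det_vandermonde_ne_zero_iff.2 fun i j hij => ?_) (by norm_num)
    exact Fin.ext (omegaRoot_four_one_isPrimitiveRoot.pow_inj i.2 j.2 hij)
  refine ⟨_, hc, det_An_four, fun lam hlam => ?_⟩
  have hz : (((lam ^ (-(1 : ℝ) / 8) : ℝ)) : ℂ) ≠ 0 :=
    Complex.ofReal_ne_zero.2 (Real.rpow_pos_of_pos hlam _).ne'
  rw [det_An_four, mul_eq_zero, or_iff_right (mul_ne_zero hc (pow_ne_zero _ hz))]
end
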